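/- (Connection formula.) Let α, β, γ be multiplicative characters of κ with α ≠ ε, α ≠ γ, β ≠ ε and β ≠ γ. Then for every λ ∈ κ with λ ≠ 0 and λ ≠ 1: F(α,β; γ; λ) = [g°(γ)·g(ᾱβ̄γ) / (g(ᾱγ)·g(β̄γ))] · F(α,β; αβγ̄; 1−λ). -/

import Mathlib

/-!
Finite-field hypergeometric functions (Otsubo), basic definitions:
`κ` is a finite field with `q = Fintype.card κ` elements, `ψ` a fixed nontrivial
additive character, multiplicative characters are `MulChar κ ℂ` (extended by `0`
on `0`, with trivial character `1`).
-/

open scoped Classical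

noncomputable section

variable {κ : Type*} [Field κ] [Fintype κ]

instance : Fintype (MulChar κ ℂ) := Fintype.ofFinite _

/-- The Gauss sum `g(φ) = -∑_{x ∈ κ} ψ(x) φ(x)`. -/
def gS (ψ : AddChar κ ℂ) (φ : MulChar κ ℂ) : ℂ := -∑ x : κ, ψ x * φ x

/-- The variant `g°(φ) = q^{δ(φ)} · g(φ)`, where `δ(φ) = 1` iff `φ` is trivial. -/
def gSo (ψ : AddChar κ ℂ) (φ : MulChar κ ℂ) : ℂ :=
  (if φ = 1 then (Fintype.card κ : ℂ) else 1) * gS ψ φ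

/-- The Pochhammer symbol `(α)_ν = g(αν)/g(α)`. -/
def poch (ψ : AddChar κ ℂ) (α ν : MulChar κ ℂ) : ℂ := gS ψ (α * ν) / gS ψ α

/-- The variant Pochhammer symbol `(α)°_ν = g°(αν)/g°(α)`. -/
def pocho (ψ : AddChar κ ℂ) (α ν : MulChar κ ℂ) : ℂ := gSo ψ (α * ν) / gSo ψ α

/-- The finite hypergeometric function
`F(α₁,…,α_r; β₁,…,β_s; λ) = (1/(1-q)) ∑_ν ((α₁)_ν ⋯ (α_r)_ν / ((ε)°_ν (β₁)°_ν ⋯ (β_s)°_ν)) ν(λ)`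
(the trivial character `ε = 1` appears implicitly among the lower parameters). -/
def Fh (ψ : AddChar κ ℂ) {r s : ℕ} (A : Fin r → MulChar κ ℂ) (B : Fin s → MulChar κ ℂ)
    (l : κ) : ℂ :=
  (1 - (Fintype.card κ : ℂ))⁻¹ *
    ∑ ν : MulChar κ ℂ,
      ((∏ i, poch ψ (A i) ν) / (pocho ψ 1 ν * ∏ j, pocho ψ (B j) ν)) * ν l

lemma gS_one {ψ : AddChar κ ℂ} (hψ : ψ ≠ 1) : gS ψ 1 = 1 := by
  have h : ∀ x : κ, ψ x * (1 : MulChar κ ℂ) x = ψ x - if x = 0 then 1 else 0 := by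
    intro x
    by_cases hx : x = 0
    · subst hx; simp [MulChar.map_zero]
    · simp [hx, MulChar.one_apply (isUnit_iff_ne_zero.mpr hx)]
  have h0 : ∑ x, ψ x = 0 := AddChar.sum_eq_zero_of_ne_one hψ
  simp [gS, h, h0]

lemma gSo_one {ψ : AddChar κ ℂ} (hψ : ψ ≠ 1) : gSo ψ 1 = Fintype.card κ := by
  simp [gSo, gS_one hψ]

lemma gS_eq_neg_gaussSum (ψ : AddChar κ ℂ) (φ : MulChar κ ℂ) : gS ψ φ = -gaussSum φ ψ := by
  simp [gS, gaussSum, mul_comm]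

lemma cast_card_ne_zero : (Fintype.card κ : ℂ) ≠ 0 := by
  exact_mod_cast Fintype.card_ne_zero

lemma MulChar.apply_neg_one_mul_self {F : Type*} [Field F] (φ : MulChar F ℂ) : φ (-1) * φ (-1) = 1 := by
  rw [← map_mul]; simp

/-- The sum `∑ ψ(a x) φ(x)` for nontrivial `φ`, including the case `a = 0`. -/
lemma sum_mul_apply_mul (ψ : AddChar κ ℂ) {φ : MulChar κ ℂ} (hφ : φ ≠ 1) (a : κ) :
    ∑ x, ψ (x * a) * φ x = -(φ⁻¹ a * gS ψ φ) := by
  by_cases ha : a = 0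
  · subst ha
    simpa [MulChar.map_zero] using MulChar.sum_eq_zero_of_ne_one hφ
  · rw [gS, mul_neg, neg_neg, Finset.mul_sum]
    refine Fintype.sum_equiv (Equiv.mulRight₀ a ha) _ _ fun x ↦ ?_
    have h : φ a ≠ 0 := ((isUnit_iff_ne_zero.mpr ha).map φ).ne_zero
    simp only [Equiv.mulRight₀_apply, map_mul, MulChar.inv_apply_eq_inv']
    field_simp

/-- Reflection formula for Gauss sums. -/
lemma gS_mul_gSo_inv {ψ : AddChar κ ℂ} (hψ : ψ ≠ 1) (φ : MulChar κ ℂ) :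
    gS ψ φ * gSo ψ φ⁻¹ = φ (-1) * Fintype.card κ := by
  by_cases hφ : φ = 1
  · subst hφ
    rw [inv_one, gSo_one hψ, gS_one hψ, MulChar.one_apply isUnit_one.neg]
  · have hφ' : φ⁻¹ ≠ 1 := inv_ne_one.mpr hφ
    have h := gaussSum_mul_gaussSum_eq_card hφ (AddChar.IsPrimitive.of_ne_one hψ)
    have h2 := sum_mul_apply_mul ψ hφ' (-1)
    have h3 : gaussSum φ⁻¹ ψ⁻¹ = -(φ (-1) * gS ψ φ⁻¹) := by
      simpa [gaussSum, mul_comm, AddChar.inv_apply] using h2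
    rw [h3] at h
    rw [gSo, if_neg hφ', one_mul, gS_eq_neg_gaussSum ψ φ, ← h]
    linear_combination (gaussSum φ ψ * gS ψ φ⁻¹) * φ.apply_neg_one_mul_self

lemma gS_mul_gS_inv {ψ : AddChar κ ℂ} (hψ : ψ ≠ 1) {φ : MulChar κ ℂ} (hφ : φ ≠ 1) :
    gS ψ φ * gS ψ φ⁻¹ = φ (-1) * Fintype.card κ := by
  rw [← gS_mul_gSo_inv hψ, gSo, if_neg (inv_ne_one.mpr hφ), one_mul]

lemma MulChar.apply_neg_one_ne_zero {F : Type*} [Field F] (φ : MulChar F ℂ) : φ (-1) ≠ 0 :=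
  left_ne_zero_of_mul_eq_one φ.apply_neg_one_mul_self

lemma gS_ne_zero {ψ : AddChar κ ℂ} (hψ : ψ ≠ 1) (φ : MulChar κ ℂ) : gS ψ φ ≠ 0 :=
  left_ne_zero_of_mul (b := gSo ψ φ⁻¹) <| by
    rw [gS_mul_gSo_inv hψ]
    exact mul_ne_zero φ.apply_neg_one_ne_zero cast_card_ne_zero

lemma inv_gSo {ψ : AddChar κ ℂ} (hψ : ψ ≠ 1) (φ : MulChar κ ℂ) :
    (gSo ψ φ)⁻¹ = gS ψ φ⁻¹ * φ (-1) / Fintype.card κ := by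
  have h := gS_mul_gSo_inv hψ φ⁻¹
  rw [inv_inv, MulChar.inv_apply', inv_neg, inv_one] at h
  have hq := cast_card_ne_zero (κ := κ)
  refine inv_eq_of_mul_eq_one_right ?_
  field_simp
  linear_combination φ (-1) * h + (Fintype.card κ : ℂ) * φ.apply_neg_one_mul_self

/-- A product of two Gauss sums as a Jacobi-type sum. -/
lemma gS_mul_gS (ψ : AddChar κ ℂ) {χ φ : MulChar κ ℂ} (h : χ * φ ≠ 1) :
    gS ψ χ * gS ψ φ = -gS ψ (χ * φ) * ∑ s, χ s * (χ * φ)⁻¹ (1 + s) := by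
  have key : gS ψ χ * gS ψ φ = ∑ w, ∑ s, ψ (w * (1 + s)) * (χ * φ) w * χ s := by
    rw [mul_comm, gS, gS, neg_mul_neg, Finset.sum_mul_sum]
    refine Finset.sum_congr rfl fun w _ ↦ ?_
    by_cases hw : w = 0
    · subst hw; simp [MulChar.map_zero]
    · refine (Fintype.sum_equiv (Equiv.mulLeft₀ w hw) _ _ fun s ↦ ?_).symm
      simp only [Equiv.mulLeft₀_apply, map_mul, MulChar.mul_apply, mul_add, mul_one,
        AddChar.map_add_eq_mul]
      ring
  rw [key, Finset.sum_comm, Finset.mul_sum]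
  refine Finset.sum_congr rfl fun s _ ↦ ?_
  rw [← Finset.sum_mul, sum_mul_apply_mul ψ h]
  ring

lemma MulChar.sum_apply_eq_ite (a : κ) :
    ∑ ν : MulChar κ ℂ, ν a = if a = 1 then (Fintype.card (MulChar κ ℂ) : ℂ) else 0 := by
  split_ifs with h
  · simp [h]
  · obtain ⟨χ, hχ⟩ := MulChar.exists_apply_ne_one_of_hasEnoughRootsOfUnity κ ℂ h
    have := Fintype.sum_equiv (Equiv.mulLeft χ) (fun ν ↦ χ a * ν a) (fun ν ↦ ν a) (fun ν ↦ by simp)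
    rw [← Finset.mul_sum] at this
    by_contra h0
    exact hχ ((mul_eq_right₀ h0).mp this)

/-- The sum over characters underlying `F(α, β; γ; l)`, evaluated as a one-variable character
sum. -/
lemma sum_gS_mul_gS (ψ : AddChar κ ℂ) {α β γ : MulChar κ ℂ} (hαγ : α ≠ γ) (hβ : β ≠ 1)
    {l : κ} (hl : l ≠ 0) :
    ∑ ν : MulChar κ ℂ,
        gS ψ (α * ν) * gS ψ (β * ν) * gS ψ ν⁻¹ * gS ψ (γ * ν)⁻¹ * ν l =
      Fintype.card (MulChar κ ℂ) * gS ψ (α * γ⁻¹) * gS ψ β *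
        ∑ s, α s * (α * γ⁻¹)⁻¹ (1 + s) * β⁻¹ (1 + s * l) := by
  have h1 (ν : MulChar κ ℂ) : α * ν * (γ * ν)⁻¹ = α * γ⁻¹ := by
    rw [mul_inv, mul_mul_mul_comm, mul_inv_cancel, mul_one]
  have h2 (ν : MulChar κ ℂ) : ν⁻¹ * (β * ν) = β := by
    rw [mul_comm β, inv_mul_cancel_left]
  have h1' : α * γ⁻¹ ≠ 1 := by rwa [Ne, mul_inv_eq_one]
  have e (ν : MulChar κ ℂ) :
      gS ψ (α * ν) * gS ψ (β * ν) * gS ψ ν⁻¹ * gS ψ (γ * ν)⁻¹ * ν l =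
      ∑ s, ∑ t, gS ψ (α * γ⁻¹) * gS ψ β * (α s * (α * γ⁻¹)⁻¹ (1 + s) * β⁻¹ (1 + t)) *
        ν (s * l * t⁻¹) := by
    have e1 := gS_mul_gS ψ (χ := α * ν) (φ := (γ * ν)⁻¹) (by rwa [h1])
    have e2 := gS_mul_gS ψ (χ := ν⁻¹) (φ := β * ν) (by rwa [h2])
    rw [h1] at e1
    rw [h2] at e2
    calc _ = (gS ψ (α * ν) * gS ψ (γ * ν)⁻¹) * (gS ψ ν⁻¹ * gS ψ (β * ν)) * ν l := by ring
      _ = gS ψ (α * γ⁻¹) * gS ψ β * ν l * ((∑ s, (α * ν) s * (α * γ⁻¹)⁻¹ (1 + s)) *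
          ∑ t, ν⁻¹ t * β⁻¹ (1 + t)) := by rw [e1, e2]; ring
      _ = _ := by
        rw [Finset.sum_mul_sum, Finset.mul_sum]
        refine Finset.sum_congr rfl fun s _ ↦ ?_
        rw [Finset.mul_sum]
        refine Finset.sum_congr rfl fun t _ ↦ ?_
        rw [map_mul, map_mul, MulChar.mul_apply, MulChar.inv_apply' ν]
        ring
  simp_rw [e]
  rw [Finset.sum_comm, Finset.mul_sum]
  refine Finset.sum_congr rfl fun s _ ↦ ?_
  rw [Finset.sum_comm]
  simp_rw [← Finset.mul_sum, MulChar.sum_apply_eq_ite]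
  by_cases hs : s = 0
  · subst hs; simp [MulChar.map_zero]
  · have (t : κ) : s * l * t⁻¹ = 1 ↔ s * l = t := by
      by_cases ht : t = 0
      · subst ht; simp [hs, hl]
      · rw [mul_inv_eq_one₀ ht]
    simp only [this, mul_ite, mul_zero, Finset.sum_ite_eq, Finset.mem_univ, if_true]
    ring

/-- The change of variables `s ↦ -s / (1 + s)` in the character sum. -/
lemma sum_apply_change_variable (α β γ : MulChar κ ℂ) (l : κ) :
    ∑ s, α s * (α * γ⁻¹)⁻¹ (1 + s) * β⁻¹ (1 + s * l) =
      α (-1) * ∑ s, α s * (β⁻¹ * γ)⁻¹ (1 + s) * β⁻¹ (1 + s * (1 - l)) := by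
  rw [Finset.mul_sum]
  have z {f : κ → ℂ} (hf : f (-1) = 0) : ∑ s, f s = ∑ s with s ≠ -1, f s := by
    rw [Finset.sum_filter]
    refine Finset.sum_congr rfl fun s _ ↦ ?_
    split_ifs with h
    · rfl
    · rw [not_not.mp h, hf]
  rw [z (by simp [MulChar.map_zero]), z (by simp [MulChar.map_zero])]
  have ne {s : κ} (hs : s ≠ -1) : 1 + s ≠ 0 := fun h ↦ hs (by linear_combination h)
  have h1 {s : κ} (hs : s ≠ -1) : 1 + -s / (1 + s) = (1 + s)⁻¹ := by
    have := ne hs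
    field_simp; ring
  have hm {s : κ} (hs : s ≠ -1) : -s / (1 + s) ≠ -1 := fun h ↦ by
    have := h1 hs
    rw [h, add_neg_cancel] at this
    exact inv_ne_zero (ne hs) this.symm
  have hi {s : κ} (hs : s ≠ -1) : -(-s / (1 + s)) / (1 + -s / (1 + s)) = s := by
    have := ne hs
    rw [h1 hs]; field_simp
  refine Finset.sum_nbij' (fun s ↦ -s / (1 + s)) (fun s ↦ -s / (1 + s)) ?_ ?_ ?_ ?_ ?_
  · intro s hs; simpa using hm (by simpa using hs)
  · intro s hs; simpa using hm (by simpa using hs)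
  · intro s hs; exact hi (by simpa using hs)
  · intro s hs; exact hi (by simpa using hs)
  · intro s hs
    have hs : s ≠ -1 := by simpa using hs
    have h0 := ne hs
    have e1 : α s = α (-1) * α (-s / (1 + s)) * α (1 + s) := by
      rw [← map_mul, ← map_mul]; congr 1; field_simp
    have e2 : β⁻¹ (1 + -s / (1 + s) * (1 - l)) = β⁻¹ (1 + s * l) * β (1 + s) := by
      have : 1 + -s / (1 + s) * (1 - l) = (1 + s * l) * (1 + s)⁻¹ := by field_simp; ring
      rw [this, map_mul, ← MulChar.inv_apply' β⁻¹, inv_inv]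
    have e3 : α (1 + s) * α⁻¹ (1 + s) = 1 := by
      rw [← MulChar.mul_apply, mul_inv_cancel, MulChar.one_apply (isUnit_iff_ne_zero.mpr h0)]
    have e4 : β (1 + s) * β⁻¹ (1 + s) = 1 := by
      rw [← MulChar.mul_apply, mul_inv_cancel, MulChar.one_apply (isUnit_iff_ne_zero.mpr h0)]
    rw [h1 hs, e1, e2, ← MulChar.inv_apply' (β⁻¹ * γ)⁻¹, inv_inv, mul_inv, inv_inv,
      MulChar.mul_apply, MulChar.mul_apply]
    linear_combination α (-1) * α (-s / (1 + s)) * γ (1 + s) * β⁻¹ (1 + s * l) * (e3 - e4)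

lemma Fh_eq_sum_gS {ψ : AddChar κ ℂ} (hψ : ψ ≠ 1) (α β γ : MulChar κ ℂ) (l : κ) :
    Fh ψ ![α, β] ![γ] l =
      (1 - (Fintype.card κ : ℂ))⁻¹ *
        (gSo ψ γ * γ (-1) / (Fintype.card κ * gS ψ α * gS ψ β)) *
        ∑ ν : MulChar κ ℂ,
          gS ψ (α * ν) * gS ψ (β * ν) * gS ψ ν⁻¹ * gS ψ (γ * ν)⁻¹ * ν l := by
  rw [Fh, mul_assoc, Finset.mul_sum _ _ (_ / _)]
  congr 1
  refine Finset.sum_congr rfl fun ν _ ↦ ?_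
  have hq := cast_card_ne_zero (κ := κ)
  have hα := gS_ne_zero hψ α
  have hβ := gS_ne_zero hψ β
  have e1 := inv_gSo hψ ν
  have e2 := inv_gSo hψ (γ * ν)
  rw [MulChar.mul_apply] at e2
  have key : (pocho ψ 1 ν * pocho ψ γ ν)⁻¹ =
      gSo ψ γ * γ (-1) / Fintype.card κ * gS ψ ν⁻¹ * gS ψ (γ * ν)⁻¹ := by
    rw [pocho, pocho, one_mul, gSo_one hψ, mul_inv, inv_div, inv_div, div_eq_mul_inv,
      div_eq_mul_inv _ (gSo ψ (γ * ν)), e1, e2]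
    field_simp
    linear_combination gS ψ ν⁻¹ * gSo ψ γ * gS ψ (γ * ν)⁻¹ * γ (-1) * ν.apply_neg_one_mul_self
  simp only [Fin.prod_univ_two, Fin.prod_univ_one, Matrix.cons_val_zero, Matrix.cons_val_one]
  rw [div_eq_mul_inv _ (pocho ψ 1 ν * _), key, poch, poch]
  field_simp

/-- connection formula: for `α ≠ ε`, `α ≠ γ`, `β ≠ ε`, `β ≠ γ`, `λ ≠ 0`, `λ ≠ 1`,
`F(α,β;γ;λ) = (g°(γ)g(ᾱβ̄γ)/(g(ᾱγ)g(β̄γ))) · F(α,β;αβγ̄;1-λ)`. -/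
theorem stmt_11 (ψ : AddChar κ ℂ) (hψ : ψ ≠ 1) (α β γ : MulChar κ ℂ)
    (hα1 : α ≠ 1) (hαγ : α ≠ γ) (hβ1 : β ≠ 1) (hβγ : β ≠ γ)
    (l : κ) (hl0 : l ≠ 0) (hl1 : l ≠ 1) :
    Fh ψ ![α, β] ![γ] l =
      (gSo ψ γ * gS ψ (α⁻¹ * β⁻¹ * γ)) / (gS ψ (α⁻¹ * γ) * gS ψ (β⁻¹ * γ)) *
        Fh ψ ![α, β] ![α * β * γ⁻¹] (1 - l) := by
  have hq := cast_card_ne_zero (κ := κ)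
  have hα := gS_ne_zero hψ α
  have hβ := gS_ne_zero hψ β
  have h1 := gS_ne_zero hψ (α⁻¹ * γ)
  have h2 := gS_ne_zero hψ (β⁻¹ * γ)
  have hγ' : α ≠ α * β * γ⁻¹ := by
    rwa [mul_assoc, Ne, left_eq_mul, mul_inv_eq_one]
  have e : α * (α * β * γ⁻¹)⁻¹ = β⁻¹ * γ := by
    rw [mul_inv, mul_inv, inv_inv, mul_assoc, mul_inv_cancel_left]
  have r1 : gS ψ (α⁻¹ * γ) * gS ψ (α * γ⁻¹) = α (-1) * γ (-1) * Fintype.card κ := by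
    have := gS_mul_gS_inv hψ (φ := α * γ⁻¹) (by rwa [Ne, mul_inv_eq_one])
    rw [mul_inv, inv_inv, MulChar.mul_apply, MulChar.inv_apply', inv_neg, inv_one] at this
    rw [mul_comm, this]
  have r2 : gS ψ (α⁻¹ * β⁻¹ * γ) * gSo ψ (α * β * γ⁻¹) * (α * β * γ⁻¹) (-1) =
      Fintype.card κ := by
    have h := gS_mul_gSo_inv hψ (α⁻¹ * β⁻¹ * γ)
    have e' : (α⁻¹ * β⁻¹ * γ)⁻¹ = α * β * γ⁻¹ := by simp only [mul_inv, inv_inv]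
    rw [e'] at h
    rw [h, mul_right_comm, ← MulChar.mul_apply, ← e', mul_inv_cancel,
      MulChar.one_apply isUnit_one.neg, one_mul]
  rw [Fh_eq_sum_gS hψ, Fh_eq_sum_gS hψ, sum_gS_mul_gS ψ hαγ hβ1 hl0,
    sum_gS_mul_gS ψ hγ' hβ1 (sub_ne_zero.mpr hl1.symm), e, sum_apply_change_variable α β γ l]
  generalize ∑ s, α s * (β⁻¹ * γ)⁻¹ (1 + s) * β⁻¹ (1 + s * (1 - l)) = S
  generalize (1 - (Fintype.card κ : ℂ))⁻¹ = k
  generalize (α * β * γ⁻¹) (-1) = c at r2 ⊢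
  have r3 : gS ψ (α * γ⁻¹) = α (-1) * γ (-1) * Fintype.card κ / gS ψ (α⁻¹ * γ) := by
    rw [← r1]; field_simp
  rw [r3]
  calc _ = k * gSo ψ γ * Fintype.card (MulChar κ ℂ) * S / (gS ψ α * gS ψ (α⁻¹ * γ)) *
        ((α (-1) * α (-1)) * (γ (-1) * γ (-1))) := by field_simp
    _ = k * gSo ψ γ * Fintype.card (MulChar κ ℂ) * S / (gS ψ α * gS ψ (α⁻¹ * γ)) *
        ((gS ψ (α⁻¹ * β⁻¹ * γ) * gSo ψ (α * β * γ⁻¹) * c) / Fintype.card κ) := by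
      rw [α.apply_neg_one_mul_self, γ.apply_neg_one_mul_self, r2, div_self hq, one_mul]
    _ = _ := by field_simp

end
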